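/- Let X be an S-concave (S ≥ 1), (C,D)-locally semi-convex complete geodesic space and let x be a (k,δ)-strained point with 0 < δ < δ_k (δ_k := k⁻¹·2^{−2k−1}). Then for every δ' ∈ (0, δ), every open neighborhood of x contains a (k,δ')-strained point. -/

import Mathlib

open Set Metric MeasureTheory Filter Topology

noncomputable section

variable {X : Type*} [MetricSpace X]

/-- A constant-speed geodesic parametrized on `[0,1]`. -/
def IsConstSpeedGeodesic (γ : ℝ → X) : Prop :=
  ∀ s ∈ Set.Icc (0:ℝ) 1, ∀ t ∈ Set.Icc (0:ℝ) 1,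
    dist (γ s) (γ t) = |s - t| * dist (γ 0) (γ 1)

/-- A unit-speed geodesic parametrized on `[a,b]`. -/
def IsUnitSpeedGeodesicOn (ξ : ℝ → X) (a b : ℝ) : Prop :=
  ∀ s ∈ Set.Icc a b, ∀ t ∈ Set.Icc a b, dist (ξ s) (ξ t) = |s - t|

/-- A geodesic space: any two points are joined by a constant-speed geodesic. -/
def IsGeodesicSpace (X : Type*) [MetricSpace X] : Prop :=
  ∀ x y : X, ∃ γ : ℝ → X, IsConstSpeedGeodesic γ ∧ γ 0 = x ∧ γ 1 = y

/-- `S`-concavity of the squared distance functions. -/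
def SConcave (X : Type*) [MetricSpace X] (S : ℝ) : Prop :=
  ∀ (p : X) (γ : ℝ → X), IsConstSpeedGeodesic γ → ∀ t ∈ Set.Icc (0:ℝ) 1,
    (1 - t) * dist p (γ 0) ^ 2 + t * dist p (γ 1) ^ 2
      - S * t * (1 - t) * dist (γ 0) (γ 1) ^ 2 ≤ dist p (γ t) ^ 2

/-- `(C,D)`-local semi-convexity of the squared distance functions. -/
def LocSemiConvex (X : Type*) [MetricSpace X] (C D : ℝ) : Prop :=
  ∀ (p : X) (γ : ℝ → X), IsConstSpeedGeodesic γ →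
    (∀ t ∈ Set.Icc (0:ℝ) 1, dist p (γ t) < D) →
    ∀ t ∈ Set.Icc (0:ℝ) 1,
      dist p (γ t) ^ 2 ≤ (1 - t) * dist p (γ 0) ^ 2 + t * dist p (γ 1) ^ 2
        + C * t * (1 - t) * dist (γ 0) (γ 1) ^ 2

/-- Busemann concavity: `t ↦ dist (γ t) (η t) / t` is non-increasing for geodesics
with a common starting point. -/
def BusemannConcave (X : Type*) [MetricSpace X] : Prop :=
  ∀ γ η : ℝ → X, IsConstSpeedGeodesic γ → IsConstSpeedGeodesic η → γ 0 = η 0 →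
    ∀ s t : ℝ, 0 < s → s ≤ t → t ≤ 1 →
      dist (γ t) (η t) / t ≤ dist (γ s) (η s) / s

/-- The Euclidean comparison angle `∠̃(p, x, q)` at the vertex `x`. -/
def compAngle (p x q : X) : ℝ :=
  Real.arccos ((dist x p ^ 2 + dist x q ^ 2 - dist p q ^ 2) / (2 * dist x p * dist x q))

/-- `p` is a `(1,δ)`-strainer at `x` with opposite strainer `q`. -/
def IsOneStrainer (S δ : ℝ) (x p q : X) : Prop :=
  p ≠ x ∧ q ≠ x ∧ Real.pi - δ < compAngle p x q ∧
    Real.arccos (1 - S * dist q x / (2 * dist p x)) < δ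

/-- The tuple `p` is a `(k,δ)`-strainer at `x` with opposite strainer `q`. -/
def IsStrainer (S C D δ : ℝ) (x : X) {k : ℕ} (p q : Fin k → X) : Prop :=
  (∀ j, IsOneStrainer S δ x (p j) (q j)) ∧
  (∀ j : Fin k, (j : ℕ) = 0 → dist (p j) x < D) ∧
  ∀ i j : Fin k, i < j →
    Real.arccos (1 - (S + C) * dist (p j) x / (2 * dist (p i) x)) < δ ∧
    |compAngle (p i) x (p j) - Real.pi / 2| < δ ∧
    |compAngle (p i) x (q j) - Real.pi / 2| < δ

/-- The set `A(k,δ)` of `(k,δ)`-strained points. -/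
def strainedPoints (X : Type*) [MetricSpace X] (S C D δ : ℝ) (k : ℕ) : Set X :=
  {x : X | ∃ p q : Fin k → X, IsStrainer S C D δ x p q}

/-- The constant `δ_k = k⁻¹ 2^{-2k-1}`. -/
def strainerDelta (k : ℕ) : ℝ := ((k : ℝ) * 2 ^ (2 * k + 1))⁻¹

/-- The `ℓ¹` distance on `Fin k → ℝ`. -/
def l1dist {k : ℕ} (u v : Fin k → ℝ) : ℝ := ∑ i, |u i - v i|

/-- `F` is an `ε`-open map on `U`, where the target carries the distance `dY`. -/
def IsEpsOpenOn {Y : Type*} (F : X → Y) (dY : Y → Y → ℝ) (U : Set X) (ε : ℝ) : Prop :=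
  ∀ x ∈ U, ∃ r > 0, Metric.closedBall x (ε⁻¹ * r) ⊆ U ∧
    IsComplete (Metric.closedBall x (ε⁻¹ * r)) ∧
    ∀ v : Y, dY (F x) v < r → ∃ y ∈ U, F y = v ∧ ε * dist x y ≤ dY (F x) v

/-- `N` is a norm on a real vector space. -/
def IsNormFn {E : Type*} [AddCommGroup E] [Module ℝ E] (N : E → ℝ) : Prop :=
  (∀ u, 0 ≤ N u) ∧ (∀ u, N u = 0 ↔ u = 0) ∧
  (∀ (a : ℝ) (u : E), N (a • u) = |a| * N u) ∧ ∀ u v, N (u + v) ≤ N u + N v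

/-- `F` is an `ε`-isometry between pointed metric spaces, the metrics being
given by the explicit distance functions `dX` and `dY`. -/
def IsEpsIsometry {Y : Type*} (dX : X → X → ℝ) (x : X) (dY : Y → Y → ℝ) (y : Y)
    (ε : ℝ) (F : X → Y) : Prop :=
  F x = y ∧
  (∀ z z' : X, dX x z < 1 / ε → dX x z' < 1 / ε →
    |dX z z' - dY (F z) (F z')| < ε) ∧
  ∀ r : ℝ, r < 1 / ε → ∀ w : Y, dY y w < r - ε →
    ∃ z : X, dX x z < r ∧ dY w (F z) ≤ ε

/-- The metric space `X` is doubling with constant `N`. -/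
def MetricDoubling (X : Type*) [MetricSpace X] (N : ℕ) : Prop :=
  ∀ (x : X) (r : ℝ), 0 < r → ∃ t : Finset X,
    (Metric.ball x r ⊆ ⋃ y ∈ t, Metric.ball y (r / 2)) ∧ t.card ≤ N

lemma cos_lt_of_arccos_lt {u θ : ℝ} (h0 : 0 ≤ θ) (h1 : θ ≤ Real.pi) (h : Real.arccos u < θ) :
    Real.cos θ < u := by
  by_contra hc
  push Not at hc
  have := Real.arccos_le_arccos hc
  rw [Real.arccos_cos h0 h1] at this
  linarith

lemma lt_cos_of_lt_arccos {u θ : ℝ} (h0 : 0 ≤ θ) (h1 : θ ≤ Real.pi) (h : θ < Real.arccos u) :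
    u < Real.cos θ := by
  by_contra hc
  push Not at hc
  have := Real.arccos_le_arccos hc
  rw [Real.arccos_cos h0 h1] at this
  linarith

lemma small_of_arccos_one_sub {u δ : ℝ} (h0 : 0 < δ) (h1 : δ < 1/2)
    (h : Real.arccos (1 - u) < δ) : u < δ^2/2 := by
  have := cos_lt_of_arccos_lt h0.le (by linarith [Real.pi_gt_three]) h
  have := Real.one_sub_sq_div_two_le_cos (x := δ)
  linarith

lemma abs_lt_of_arccos_near {u δ : ℝ} (h0 : 0 < δ) (h1 : δ < 1/2)
    (h : |Real.arccos u - Real.pi / 2| < δ) : |u| < δ := by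
  have hp := Real.pi_gt_three
  obtain ⟨ha, hb⟩ := abs_lt.1 h
  have h2 := cos_lt_of_arccos_lt (u := u) (θ := δ + Real.pi/2) (by linarith) (by linarith)
    (by linarith)
  have h3 := lt_cos_of_lt_arccos (u := u) (θ := Real.pi/2 - δ) (by linarith) (by linarith)
    (by linarith)
  rw [Real.cos_add_pi_div_two] at h2
  rw [Real.cos_pi_div_two_sub] at h3
  have := Real.sin_lt h0
  exact abs_lt.2 ⟨by linarith, by linarith⟩

/-- lower rate -/
lemma rate_lower {X : Type*} [MetricSpace X] {S : ℝ} (hS : 1 ≤ S) (hconc : SConcave X S)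
    (p w q : X) (hp : p ≠ w) (hq : q ≠ w) (ξ : ℝ → X) (hξ : IsConstSpeedGeodesic ξ)
    (h0 : ξ 0 = w) (h1 : ξ 1 = q) (ρ : ℝ)
    (hρ : ρ < (dist p q ^ 2 - dist p w ^ 2 - S * dist w q ^ 2) / (2 * dist p w * dist w q)) :
    ∀ᶠ t in 𝓝[>] (0:ℝ), t * dist w q * ρ ≤ dist p (ξ t) - dist p w := by
  set a := dist p w with ha
  set b := dist w q with hb
  have ha0 : 0 < a := dist_pos.2 hp
  have hb0 : 0 < b := dist_pos.2 hq.symm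
  set R := (dist p q ^ 2 - a ^ 2 - S * b ^ 2) / (2 * a * b) with hR
  have hRe : R * (2 * a * b) = dist p q ^ 2 - a ^ 2 - S * b ^ 2 := by
    rw [hR]; field_simp
  have hη : 0 < (R - ρ) * (2 * a) / b := by
    apply div_pos _ hb0; apply mul_pos <;> linarith
  filter_upwards [Ioo_mem_nhdsGT (lt_min one_pos hη)] with t ht
  obtain ⟨ht0, ht1⟩ := ht
  have ht1' := ht1.trans_le (min_le_left _ _)
  have ht2 := ht1.trans_le (min_le_right _ _)
  rw [lt_div_iff₀ hb0] at ht2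
  have htI : t ∈ Set.Icc (0:ℝ) 1 := ⟨ht0.le, ht1'.le⟩
  have hc := hconc p ξ hξ t htI
  have hd := hξ 0 (by simp) t htI
  rw [h0, h1, ← hb] at hd hc
  rw [← ha] at hc
  rw [zero_sub, abs_neg, abs_of_pos ht0] at hd
  set e := dist p (ξ t) with he
  have h3 : |e - a| ≤ t * b := by
    rw [← hd, he, ha, dist_comm w, dist_comm p, dist_comm p]; exact abs_dist_sub_le _ _ _
  have h4 : (e - a)^2 ≤ (t*b)^2 := sq_le_sq' (abs_le.1 h3).1 (abs_le.1 h3).2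
  have h5 : t * (R * (2*a*b)) ≤ e^2 - a^2 := by
    rw [hRe]; nlinarith [mul_pos (mul_pos ht0 ht0) (sq_pos_of_pos hb0)]
  have h6 : t*b*(t*b) ≤ t*b*((R-ρ)*(2*a)) := by
    apply mul_le_mul_of_nonneg_left ht2.le; positivity
  have h7 : (t*b*ρ) * (2*a) ≤ (e-a)*(2*a) := by nlinarith
  exact le_of_mul_le_mul_right h7 (by positivity)

lemma rate_upper {X : Type*} [MetricSpace X] {C D : ℝ} (hC : 0 ≤ C) (hsemi : LocSemiConvex X C D)
    (p w q : X) (hp : p ≠ w) (hq : q ≠ w) (ξ : ℝ → X) (hξ : IsConstSpeedGeodesic ξ)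
    (h0 : ξ 0 = w) (h1 : ξ 1 = q) (hD : dist p w + dist w q < D) (ρ : ℝ)
    (hρ : (dist p q ^ 2 - dist p w ^ 2 + C * dist w q ^ 2) / (2 * dist p w * dist w q) ≤ ρ)
    (t : ℝ) (htI : t ∈ Set.Icc (0:ℝ) 1) :
    dist p (ξ t) - dist p w ≤ t * dist w q * ρ := by
  set a := dist p w with ha
  set b := dist w q with hb
  have ha0 : 0 < a := dist_pos.2 hp
  have hb0 : 0 < b := dist_pos.2 hq.symm
  have hdd : ∀ t ∈ Set.Icc (0:ℝ) 1, dist w (ξ t) = t * b := by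
    intro t ht
    have hd := hξ 0 (by simp) t ht
    rw [h0, h1, ← hb] at hd
    rw [zero_sub, abs_neg, abs_of_nonneg ht.1] at hd
    exact hd
  have hc := hsemi p ξ hξ (by
    intro t ht
    have := dist_triangle p w (ξ t)
    rw [hdd t ht] at this
    nlinarith [ht.1, ht.2]) t htI
  rw [h0, h1, ← hb, ← ha] at hc
  rw [div_le_iff₀ (by positivity)] at hρ
  set e := dist p (ξ t) with he
  have h5 : e^2 - a^2 ≤ t * (ρ * (2*a*b)) := by
    have := mul_le_mul_of_nonneg_left hρ htI.1
    nlinarith [mul_nonneg (mul_nonneg hC (mul_nonneg htI.1 htI.1)) (sq_nonneg b)]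
  have h7 : (e-a)*(2*a) ≤ (t*b*ρ) * (2*a) := by nlinarith [sq_nonneg (e-a)]
  exact le_of_mul_le_mul_right h7 (by positivity)

/-- Directional rates of change of the distance functions at `w`. -/
def RateAt {X : Type*} [MetricSpace X] {k : ℕ} (p : Fin k → X) (w : X) (σ : ℝ)
    (safe : Fin k → Prop) : Prop :=
  ∀ l : Fin k, ∀ s : ℝ, (s = 1 ∨ s = -1) → ∃ (ξ : ℝ → X) (b : ℝ), 0 < b ∧
    (∀ t ∈ Set.Icc (0:ℝ) 1, dist w (ξ t) = t * b) ∧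
    ∀ᶠ t in 𝓝[>] (0:ℝ),
      t * b * (1 - σ) ≤ s * (dist (p l) (ξ t) - dist (p l) w) ∧
      ∀ i < l, -(t * b * σ) ≤ dist (p i) (ξ t) - dist (p i) w ∧
        (safe i → dist (p i) (ξ t) - dist (p i) w ≤ t * b * σ)

lemma rateAt_of_strainer {X : Type*} [MetricSpace X]
    (S C D : ℝ) (hS : 1 ≤ S) (hC : 0 ≤ C)
    (hgeo : IsGeodesicSpace X) (hconc : SConcave X S)
    (hsemi : LocSemiConvex X C D)
    {k : ℕ} (δ D₀ : ℝ) (hδ0 : 0 < δ) (hδ : δ < 1/2) (hD₀ : D₀ ≤ D) (w : X) (p q : Fin k → X)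
    (h : IsStrainer S C D₀ δ w p q) :
    RateAt p w (2 * δ) (fun i => (i : ℕ) ≠ 0 ∨ D₀ ≤ D / 2) := by
  obtain ⟨hA, hB, hE⟩ := h
  have hpp : ∀ i, 0 < dist (p i) w := fun i => dist_pos.2 (hA i).1
  have hδ2 : δ^2 < δ / 2 := by nlinarith
  -- ratio facts
  have hqp : ∀ i, dist (q i) w < dist (p i) w := by
    intro i
    have h1 := small_of_arccos_one_sub hδ0 hδ (hA i).2.2.2
    rw [div_lt_iff₀ (by linarith [hpp i])] at h1
    have h2 : 0 ≤ dist (q i) w := dist_nonneg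
    nlinarith [hpp i]
  have hrat : ∀ i j, i < j → (S + C) * dist (p j) w / (2 * dist (p i) w) < δ^2/2 := by
    intro i j hij
    exact small_of_arccos_one_sub hδ0 hδ (hE i j hij).1
  -- the common estimate
  have key : ∀ (l : Fin k) (z : X), z ≠ w → dist z w ≤ dist (p l) w →
      (∀ i < l, |compAngle (p i) w z - Real.pi / 2| < δ) →
      ∀ ξ : ℝ → X, IsConstSpeedGeodesic ξ → ξ 0 = w → ξ 1 = z →
      ∀ᶠ t in 𝓝[>] (0:ℝ), ∀ i < l,
        -(t * dist w z * (2*δ)) ≤ dist (p i) (ξ t) - dist (p i) w ∧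
        (((i : ℕ) ≠ 0 ∨ D₀ ≤ D / 2) → dist (p i) (ξ t) - dist (p i) w ≤ t * dist w z * (2*δ)) := by
    intro l z hz hzl hang ξ hξ h0 h1
    rw [Filter.eventually_all]
    intro i
    by_cases hil : i < l
    swap
    · exact Eventually.of_forall fun t h => absurd h hil
    have hb0 : 0 < dist w z := dist_pos.2 hz.symm
    have ha0 := hpp i
    have hu := abs_lt.1 (abs_lt_of_arccos_near hδ0 hδ (hang i hil))
    have hr := hrat i l hil
    rw [div_lt_iff₀ (by linarith)] at hr
    rw [dist_comm w (p i)] at hu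
    rw [dist_comm z w] at hzl
    set a := dist (p i) w with ha
    set b := dist w z with hb
    set c := dist (p i) z with hc
    have hSb : (S + C) * b < δ^2 * a := by nlinarith
    have hu1 := hu.1
    have hu2 := hu.2
    rw [lt_div_iff₀ (by positivity)] at hu1
    rw [div_lt_iff₀ (by positivity)] at hu2
    have hSb2 : (S + C) * b * b < δ^2 * a * b := mul_lt_mul_of_pos_right hSb hb0
    have hdab : δ^2 * a * b < δ/2 * a * b := by
      rw [mul_assoc, mul_assoc]
      exact mul_lt_mul_of_pos_right hδ2 (by positivity)
    have hCb : 0 ≤ C * b * b := by positivity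
    have hSb' : b * b ≤ S * b * b := by nlinarith [mul_pos hb0 hb0]
    have hlow := rate_lower hS hconc (p i) w z (hA i).1 hz ξ hξ h0 h1 (-(2*δ)) (by
      rw [lt_div_iff₀ (by positivity)]
      nlinarith [mul_pos hδ0 (mul_pos ha0 hb0)])
    filter_upwards [hlow, Ioo_mem_nhdsGT one_pos] with t ht htt _
    refine ⟨by linarith, fun hsafe => ?_⟩
    refine rate_upper hC hsemi (p i) w z (hA i).1 hz ξ hξ h0 h1 ?_ (2*δ) ?_ t ⟨htt.1.le, htt.2.le⟩
    · have hba : b < a := by nlinarith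
      rw [← ha, ← hb]
      rcases hsafe with hne | hs
      · have hk : 0 < k := lt_of_le_of_lt (Nat.zero_le _) i.2
        have h0i : (⟨0, hk⟩ : Fin k) < i := Fin.lt_def.2 (Nat.pos_of_ne_zero hne)
        have hr0 := hrat _ i h0i
        have hd0 := hB ⟨0, hk⟩ rfl
        have hpo := hpp ⟨0, hk⟩
        rw [div_lt_iff₀ (by linarith)] at hr0
        nlinarith
      · by_cases hi0 : (i : ℕ) = 0
        · have := hB i hi0
          linarith
        · have hk : 0 < k := lt_of_le_of_lt (Nat.zero_le _) i.2
          have h0i : (⟨0, hk⟩ : Fin k) < i := Fin.lt_def.2 (Nat.pos_of_ne_zero hi0)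
          have hr0 := hrat _ i h0i
          have hd0 := hB ⟨0, hk⟩ rfl
          have hpo := hpp ⟨0, hk⟩
          rw [div_lt_iff₀ (by linarith)] at hr0
          nlinarith
    · rw [div_le_iff₀ (by positivity)]
      nlinarith [mul_pos hδ0 (mul_pos ha0 hb0)]
  have hcurve : ∀ (z : X) (ξ : ℝ → X), IsConstSpeedGeodesic ξ → ξ 0 = w → ξ 1 = z →
      ∀ t ∈ Set.Icc (0:ℝ) 1, dist w (ξ t) = t * dist w z := by
    intro z ξ hξ h0 h1 t ht
    have hd := hξ 0 (by simp) t ht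
    rw [h0, h1] at hd
    rw [zero_sub, abs_neg, abs_of_nonneg ht.1] at hd
    exact hd
  intro l s hs
  rcases hs with rfl | rfl
  · obtain ⟨ξ, hξ, h0, h1⟩ := hgeo w (q l)
    have hb0 : 0 < dist w (q l) := dist_pos.2 (hA l).2.1.symm
    refine ⟨ξ, dist w (q l), hb0, hcurve _ ξ hξ h0 h1, ?_⟩
    have hk := key l (q l) (hA l).2.1 (hqp l).le (fun i hi => (hE i l hi).2.2) ξ hξ h0 h1
    have h3 := small_of_arccos_one_sub hδ0 hδ (hA l).2.2.2
    have h4 := lt_cos_of_lt_arccos (by linarith [Real.pi_gt_three]) (by linarith) (hA l).2.2.1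
    rw [Real.cos_pi_sub] at h4
    have h5 := Real.one_sub_sq_div_two_le_cos (x := δ)
    have ha0 := hpp l
    rw [dist_comm w (p l), div_lt_iff₀ (by positivity)] at h4
    rw [dist_comm (q l) w, div_lt_iff₀ (by positivity)] at h3
    have hlow := rate_lower hS hconc (p l) w (q l) (hA l).1 (hA l).2.1 ξ hξ h0 h1 (1-2*δ) (by
      rw [lt_div_iff₀ (by positivity)]
      set a := dist (p l) w with ha
      set b := dist w (q l) with hb
      set c := dist (p l) (q l) with hc
      have hab : 0 < a * b := mul_pos ha0 hb0
      have h6 : S * b * b ≤ δ^2/2 * (2*a) * b := mul_le_mul_of_nonneg_right h3.le hb0.le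
      have h7 : (1 - δ^2/2) * (a*b) ≤ Real.cos δ * (a*b) := mul_le_mul_of_nonneg_right (by linarith) hab.le
      nlinarith [mul_lt_mul_of_pos_right hδ2 hab])
    filter_upwards [hk, hlow] with t h8 h9
    exact ⟨by linarith, h8⟩
  · obtain ⟨ξ, hξ, h0, h1⟩ := hgeo w (p l)
    have hb0 : 0 < dist w (p l) := dist_pos.2 (hA l).1.symm
    refine ⟨ξ, dist w (p l), hb0, hcurve _ ξ hξ h0 h1, ?_⟩
    have hk := key l (p l) (hA l).1 le_rfl (fun i hi => (hE i l hi).2.1) ξ hξ h0 h1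
    filter_upwards [hk, Ioo_mem_nhdsGT one_pos] with t h8 h9
    refine ⟨?_, h8⟩
    have hd := hξ 1 (by simp) t ⟨h9.1.le, h9.2.le⟩
    rw [h0, h1, abs_of_pos (by linarith [h9.2])] at hd
    rw [hd, dist_comm (p l) w]
    nlinarith [mul_pos (mul_pos h9.1 hb0) hδ0]
lemma geom_bound : ∀ (k : ℕ) (a : Fin k → ℝ) (K : ℝ), 
    (∀ l, a l ≤ K + ∑ i, if l < i then a i else 0) → ∑ i, a i ≤ (2^k - 1) * K := by
  intro k
  induction k with
  | zero => intro a K _; simp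
  | succ n ih =>
    intro a K h
    have h1 := ih (fun i => a i.succ) K (by
      intro l
      have := h l.succ
      rw [Fin.sum_univ_succ] at this
      simpa [Fin.succ_lt_succ_iff] using this)
    have h2 := h 0
    rw [Fin.sum_univ_succ] at h2 ⊢
    simp only [lt_self_iff_false, if_false, Fin.succ_pos, if_true, zero_add] at h2
    rw [pow_succ]
    linarith

lemma weight_sum : ∀ (k : ℕ) (l : Fin k),
    (∑ i : Fin k, if l < i then ((1:ℝ)/2)^(i:ℕ) else 0) = (1/2)^(l:ℕ) - 2 * (1/2)^k := by
  intro k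
  induction k with
  | zero => intro l; exact l.elim0
  | succ n ih =>
    intro l
    rw [Fin.sum_univ_castSucc]
    induction l using Fin.lastCases with
    | last =>
      have : ∀ i : Fin n, ¬ (Fin.last n < i.castSucc) := fun i => not_lt.2 (Fin.le_last _)
      simp [this, pow_succ]
      ring
    | cast l =>
      simp only [Fin.castSucc_lt_castSucc_iff, Fin.castSucc_lt_last, if_true, Fin.val_castSucc,
        Fin.val_last]
      rw [ih l, pow_succ]; ring

/-- No nontrivial linear combination of the distance functions is stationary. -/
lemma no_stationary {X : Type*} [MetricSpace X] {k : ℕ} (p : Fin k → X) (w : X) (σ : ℝ)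
    (hσ0 : 0 ≤ σ) (hσ : 2^k * σ ≤ 1)
    (hr : RateAt p w σ (fun i => (i : ℕ) ≠ 0)) (c : Fin k → ℝ)
    (hc0 : ∀ i : Fin k, (i : ℕ) = 0 → 0 ≤ c i)
    (hc : ∀ η > 0, ∀ᶠ z in 𝓝 w, |∑ i, c i * (dist (p i) z - dist (p i) w)| ≤ η * dist z w) :
    c = 0 := by
  set M := ∑ i, |c i| with hM
  have hM0 : 0 ≤ M := Finset.sum_nonneg fun i _ => abs_nonneg _
  have key : ∀ l, |c l| ≤ σ * M + ∑ i, if l < i then |c i| else 0 := by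
    intro l
    apply le_of_forall_pos_le_add
    intro η hη
    obtain ⟨s, hs, hsc⟩ : ∃ s : ℝ, (s = 1 ∨ s = -1) ∧ c l = s * |c l| := by
      rcases le_total 0 (c l) with h | h
      · exact ⟨1, Or.inl rfl, by rw [abs_of_nonneg h]; ring⟩
      · exact ⟨-1, Or.inr rfl, by rw [abs_of_nonpos h]; ring⟩
    obtain ⟨ξ, b, hb, hd, hev⟩ := hr l s hs
    have htend : Tendsto ξ (𝓝[>] 0) (𝓝 w) := by
      rw [tendsto_iff_dist_tendsto_zero]
      have : Tendsto (fun t : ℝ => t * b) (𝓝[>] 0) (𝓝 0) := by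
        have : Tendsto (fun t : ℝ => t * b) (𝓝 0) (𝓝 (0*b)) :=
          (continuous_id.mul continuous_const).tendsto 0
        rw [zero_mul] at this
        exact this.mono_left nhdsWithin_le_nhds
      refine this.congr' ?_
      filter_upwards [Ioo_mem_nhdsGT one_pos] with t ht
      rw [dist_comm, hd t ⟨ht.1.le, ht.2.le⟩]
    obtain ⟨t, ⟨hev1, hev2⟩, hcz, ht⟩ :=
      (hev.and ((htend.eventually (hc η hη)).and (Ioo_mem_nhdsGT one_pos))).exists
    have hdt := hd t ⟨ht.1.le, ht.2.le⟩
    rw [dist_comm] at hdt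
    rw [hdt] at hcz
    have htb : 0 < t * b := mul_pos ht.1 hb
    have hterm : ∀ i, t * b * ((if i = l then |c l| else 0) - σ * |c i| - (if l < i then |c i| else 0))
        ≤ c i * (dist (p i) (ξ t) - dist (p i) w) := by
      intro i
      have hlip : |dist (p i) (ξ t) - dist (p i) w| ≤ t * b := by
        rw [← hdt, dist_comm (p i), dist_comm (p i)]; exact abs_dist_sub_le _ _ _
      set Δ := dist (p i) (ξ t) - dist (p i) w with hΔ
      rcases lt_trichotomy i l with h | h | h
      · rw [if_neg h.ne, if_neg (not_lt.2 h.le)]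
        obtain ⟨h1, h2⟩ := hev2 i h
        by_cases hi : (i : ℕ) = 0
        · have := hc0 i hi
          rw [abs_of_nonneg this]
          nlinarith
        · have h3 : |Δ| ≤ t * b * σ := abs_le.2 ⟨h1, h2 hi⟩
          have h4 := neg_abs_le (c i * Δ)
          rw [abs_mul] at h4
          nlinarith [abs_nonneg (c i)]
      · subst h
        rw [if_pos rfl, if_neg (lt_irrefl _)]
        have : c i * Δ = |c i| * (s * Δ) := by rw [hsc]; rw [abs_mul, abs_abs]; rcases hs with rfl | rfl <;> simp
        rw [this]
        nlinarith [abs_nonneg (c i)]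
      · rw [if_neg h.ne', if_pos h]
        have h4 := neg_abs_le (c i * Δ)
        rw [abs_mul] at h4
        have := mul_nonneg (mul_nonneg htb.le hσ0) (abs_nonneg (c i))
        nlinarith [abs_nonneg (c i)]
    have hsum := Finset.sum_le_sum (s := Finset.univ) fun i _ => hterm i
    rw [← Finset.mul_sum, Finset.sum_sub_distrib, Finset.sum_sub_distrib, ← Finset.mul_sum,
      Finset.sum_ite_eq' Finset.univ l, if_pos (Finset.mem_univ _), ← hM] at hsum
    have h5 := hsum.trans ((le_abs_self _).trans hcz)
    have h6 : t * b * (|c l| - σ * M - ∑ i, if l < i then |c i| else 0) ≤ t * b * η := by linarith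
    have := le_of_mul_le_mul_left h6 htb
    linarith
  have h7 := geom_bound k (fun i => |c i|) (σ * M) key
  rw [← hM] at h7
  have h8 : M ≤ 0 := by
    rcases eq_or_lt_of_le hσ0 with h | h
    · rw [← h] at h7; linarith
    · by_contra hcon
      push Not at hcon
      nlinarith [mul_pos h hcon, mul_le_mul_of_nonneg_right hσ hM0]
  funext i
  have h9 : |c i| ≤ M := Finset.single_le_sum (f := fun i => |c i|) (fun i _ => abs_nonneg _) (Finset.mem_univ i)
  exact abs_eq_zero.1 (le_antisymm (h9.trans h8) (abs_nonneg _))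

/-- Openness of the distance map. -/
lemma open_map {X : Type*} [MetricSpace X] [CompleteSpace X] {j : ℕ} (p : Fin j → X) (y : X)
    (r η σ : ℝ) (hr : 0 < r) (hη : 0 < η) (hσ0 : 0 ≤ σ) (hσ : j * σ ≤ (1/2)^j)
    (hanti : ∀ z ∈ closedBall y r, ∀ w ∈ closedBall y r,
      η * dist z w ≤ dist (fun i => dist (p i) z) (fun i => dist (p i) w))
    (hrate : ∀ w ∈ ball y r, RateAt p w σ (fun _ => True)) :
    ∃ ρ > 0, ∀ v ∈ ball (fun i => dist (p i) y) ρ, ∃ w ∈ ball y r, (fun i => dist (p i) w) = v := by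
  have hcpt : IsCompact (closedBall y r) := by
    let G : closedBall y r → (Fin j → ℝ) := fun z i => dist (p i) (z : X)
    have hGlip : LipschitzWith 1 G := by
      apply LipschitzWith.of_dist_le_mul
      intro z w
      rw [NNReal.coe_one, one_mul, dist_pi_le_iff dist_nonneg]
      intro i
      change |dist (p i) (z : X) - dist (p i) (w : X)| ≤ dist (z : X) w
      rw [dist_comm (p i), dist_comm (p i)]
      exact abs_dist_sub_le _ _ _
    have hGanti : AntilipschitzWith (Real.toNNReal η⁻¹) G := by
      apply AntilipschitzWith.of_le_mul_dist
      intro z w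
      rw [Real.coe_toNNReal _ (by positivity)]
      have := hanti z z.2 w w.2
      rw [← div_eq_inv_mul, le_div_iff₀ hη, mul_comm]
      exact this
    have : CompleteSpace (closedBall y r) := (isClosed_closedBall.isComplete).completeSpace_coe
    have hce := hGanti.isClosedEmbedding hGlip.uniformContinuous
    have hbdd : Bornology.IsBounded (range G) := by
      rw [← image_univ]
      apply hGlip.isBounded_image
      rw [Metric.isBounded_iff]
      refine ⟨2 * r, fun z _ w _ => ?_⟩
      have h1 := z.2
      have h2 := w.2
      rw [mem_closedBall] at h1 h2
      have := dist_triangle_right (z : X) w y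
      rw [Subtype.dist_eq]; linarith
    have hc : IsCompact (range G) := Metric.isCompact_of_isClosed_isBounded hce.isClosed_range hbdd
    rw [isCompact_iff_compactSpace, ← isCompact_univ_iff]
    have := hce.isCompact_preimage hc
    rwa [preimage_range] at this
  set c : ℝ := (1/2)^j / 2 with hcdef
  have hc0 : 0 < c := by positivity
  refine ⟨c * r / (j + 1), by positivity, fun v hv => ?_⟩
  let Φ : X → ℝ := fun w => ∑ i : Fin j, (1/2:ℝ)^(i:ℕ) * |v i - dist (p i) w|
  have hcont : ContinuousOn (fun w => Φ w + c * dist w y) (closedBall y r) := by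
    apply Continuous.continuousOn
    fun_prop
  obtain ⟨w, hw, hmin⟩ := hcpt.exists_isMinOn ⟨y, mem_closedBall_self hr.le⟩ hcont
  have hmin' : ∀ z ∈ closedBall y r, Φ w + c * dist w y ≤ Φ z + c * dist z y := fun z hz => hmin hz
  have hΦ0 : 0 ≤ Φ w := Finset.sum_nonneg fun i _ => by positivity
  have hΦy : Φ y < c * r := by
    have h1 : Φ y ≤ ∑ i : Fin j, dist v (fun i => dist (p i) y) := by
      apply Finset.sum_le_sum
      intro i _
      have h2 : |v i - dist (p i) y| ≤ dist v (fun i => dist (p i) y) := by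
        rw [← Real.dist_eq]
        exact dist_le_pi_dist v (fun i => dist (p i) y) i
      have h3 : (1/2:ℝ)^(i:ℕ) ≤ 1 := pow_le_one₀ (by norm_num) (by norm_num)
      nlinarith [abs_nonneg (v i - dist (p i) y)]
    rw [Finset.sum_const, Finset.card_univ, Fintype.card_fin, nsmul_eq_mul] at h1
    rw [mem_ball, lt_div_iff₀ (by positivity)] at hv
    have h0 : 0 ≤ dist v (fun i => dist (p i) y) := dist_nonneg
    nlinarith
  have hwr : dist w y < r := by
    have := hmin' y (mem_closedBall_self hr.le)
    rw [dist_self, mul_zero, add_zero] at this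
    have : c * dist w y < c * r := by linarith
    exact lt_of_mul_lt_mul_left this hc0.le
  refine ⟨w, hwr, ?_⟩
  by_contra hne
  obtain ⟨l, hl⟩ : ∃ l, dist (p l) w ≠ v l := by
    by_contra h
    push Not at h
    exact hne (funext h)
  have hel : v l - dist (p l) w ≠ 0 := sub_ne_zero.2 hl.symm
  obtain ⟨s, hs, hsc⟩ : ∃ s : ℝ, (s = 1 ∨ s = -1) ∧ v l - dist (p l) w = s * |v l - dist (p l) w| := by
    rcases le_total 0 (v l - dist (p l) w) with h | h
    · exact ⟨1, Or.inl rfl, by rw [abs_of_nonneg h]; ring⟩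
    · exact ⟨-1, Or.inr rfl, by rw [abs_of_nonpos h]; ring⟩
  obtain ⟨ξ, b, hb, hd, hev⟩ := hrate w hwr l s hs
  have hpos : 0 < min 1 (min (|v l - dist (p l) w| / b) ((r - dist w y) / b)) := by
    refine lt_min one_pos (lt_min (div_pos (abs_pos.2 hel) hb) (div_pos (by linarith) hb))
  obtain ⟨t, ⟨hev1, hev2⟩, ht0, htm⟩ := (hev.and (Ioo_mem_nhdsGT hpos)).exists
  rw [lt_min_iff, lt_min_iff, lt_div_iff₀ hb, lt_div_iff₀ hb] at htm
  obtain ⟨ht1, ht2, ht3⟩ := htm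
  have hdt := hd t ⟨ht0.le, ht1.le⟩
  rw [dist_comm] at hdt
  have htb : 0 < t * b := mul_pos ht0 hb
  have htri := dist_triangle (ξ t) w y
  have hmem : ξ t ∈ closedBall y r := by
    rw [mem_closedBall]; linarith
  have h1 := hmin' _ hmem
  have hterm : ∀ i : Fin j, (1/2:ℝ)^(i:ℕ) * |v i - dist (p i) (ξ t)| ≤
      (1/2:ℝ)^(i:ℕ) * |v i - dist (p i) w| + t * b * (σ
        - (if i = l then (1/2:ℝ)^(l:ℕ) else 0) + (if l < i then (1/2:ℝ)^(i:ℕ) else 0)) := by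
    intro i
    have hlip : |dist (p i) (ξ t) - dist (p i) w| ≤ t * b := by
      rw [← hdt, dist_comm (p i), dist_comm (p i)]; exact abs_dist_sub_le _ _ _
    have hl0 : 0 < (1/2:ℝ)^(i:ℕ) := by positivity
    have hl1 : (1/2:ℝ)^(i:ℕ) ≤ 1 := pow_le_one₀ (by norm_num) (by norm_num)
    set Λ := (1/2:ℝ)^(i:ℕ) with hΛ
    have hE : v i - dist (p i) (ξ t) = (v i - dist (p i) w) - (dist (p i) (ξ t) - dist (p i) w) := by ring
    have htσ : 0 ≤ t * b * σ := by positivity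
    have h3 : |v i - dist (p i) (ξ t)| ≤ |v i - dist (p i) w| + |dist (p i) (ξ t) - dist (p i) w| := by
      rw [hE]; exact abs_sub _ _
    rcases lt_trichotomy i l with h | h | h
    · rw [if_neg h.ne, if_neg (not_lt.2 h.le)]
      obtain ⟨h5, h6⟩ := hev2 i h
      have h4 : |dist (p i) (ξ t) - dist (p i) w| ≤ t * b * σ := abs_le.2 ⟨h5, h6 trivial⟩
      have := mul_le_mul_of_nonneg_left (h3.trans (add_le_add_right h4 _)) hl0.le
      nlinarith
    · subst h
      rw [if_pos rfl, if_neg (lt_irrefl _)]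
      have h4 : |v i - dist (p i) (ξ t)| ≤ |v i - dist (p i) w| - t * b * (1 - σ) := by
        rw [hE]
        rcases hs with rfl | rfl
        · rw [one_mul] at hsc hev1
          rw [← hsc] at ht2 ⊢
          have := abs_le.1 hlip
          rw [abs_of_nonneg (by linarith)]
          linarith
        · have := abs_le.1 hlip
          rw [abs_of_nonpos (by linarith)]
          linarith
      have := mul_le_mul_of_nonneg_left h4 hl0.le
      nlinarith
    · rw [if_neg h.ne', if_pos h]
      have := mul_le_mul_of_nonneg_left (h3.trans (add_le_add_right hlip _)) hl0.le
      nlinarith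
  have hsum : Φ (ξ t) ≤ Φ w + t * b * (j * σ - (1/2:ℝ)^(l:ℕ) + ((1/2)^(l:ℕ) - 2 * (1/2)^j)) := by
    have := Finset.sum_le_sum (s := Finset.univ) fun i _ => hterm i
    rw [Finset.sum_add_distrib, ← Finset.mul_sum, Finset.sum_add_distrib, Finset.sum_sub_distrib,
      Finset.sum_ite_eq' Finset.univ l, if_pos (Finset.mem_univ _), weight_sum, Finset.sum_const,
      Finset.card_univ, Fintype.card_fin, nsmul_eq_mul] at this
    exact this
  have h5 : Φ (ξ t) ≤ Φ w - t * b * (1/2)^j := by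
    have := mul_le_mul_of_nonneg_left hσ htb.le
    nlinarith
  have h6 : c * dist (ξ t) y ≤ c * (dist w y + t * b) := by
    apply mul_le_mul_of_nonneg_left _ hc0.le; linarith
  have h7 : 0 < t * b * c := by positivity
  have h8 : (1/2:ℝ)^j = 2 * c := by rw [hcdef]; ring
  rw [h8] at h5
  nlinarith

/-- Rademacher: a stationary combination at some point. -/
lemma exists_stationary {X : Type*} [MetricSpace X] {j k : ℕ} (hjk : j < k) (p' : Fin j → X)
    (p : Fin k → X) (y : X)
    (r η ρ : ℝ) (hη : 0 < η) (hρ : 0 < ρ)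
    (hanti : ∀ z ∈ closedBall y r, ∀ w ∈ closedBall y r,
      η * dist z w ≤ dist (fun i => dist (p' i) z) (fun i => dist (p' i) w))
    (hopen : ∀ v ∈ ball (fun i => dist (p' i) y) ρ, ∃ w ∈ ball y r, (fun i => dist (p' i) w) = v) :
    ∃ w ∈ ball y r, ∃ c : Fin k → ℝ, c ≠ 0 ∧
      ∀ ε > 0, ∀ᶠ z in 𝓝 w, |∑ i, c i * (dist (p i) z - dist (p i) w)| ≤ ε * dist z w := by
  set G : X → (Fin j → ℝ) := fun z i => dist (p' i) z with hG
  set O := ball (G y) ρ with hO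
  have hGlip : ∀ z w, dist (G z) (G w) ≤ dist z w := by
    intro z w
    rw [dist_pi_le_iff dist_nonneg]
    intro i
    change |dist (p' i) z - dist (p' i) w| ≤ dist z w
    rw [dist_comm (p' i), dist_comm (p' i)]
    exact abs_dist_sub_le _ _ _
  have hGcont : Continuous G := by fun_prop
  have : Nonempty X := ⟨y⟩
  choose! φ hφ1 hφ2 using hopen
  have hφ2' : ∀ v ∈ O, G (φ v) = v := hφ2
  let g : (Fin j → ℝ) → (Fin k → ℝ) := fun v i => dist (p i) (φ v)
  have hglip : LipschitzOnWith (Real.toNNReal η⁻¹) g O := by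
    apply LipschitzOnWith.of_dist_le_mul
    intro u hu v hv
    rw [Real.coe_toNNReal _ (by positivity), dist_pi_le_iff (by positivity)]
    intro i
    have h1 := hanti _ (ball_subset_closedBall (hφ1 u hu)) _ (ball_subset_closedBall (hφ1 v hv))
    rw [hφ2 u hu, hφ2 v hv] at h1
    rw [← div_eq_inv_mul, le_div_iff₀ hη, mul_comm]
    refine le_trans (mul_le_mul_of_nonneg_left ?_ hη.le) h1
    change |dist (p i) (φ u) - dist (p i) (φ v)| ≤ dist (φ u) (φ v)
    rw [dist_comm (p i), dist_comm (p i)]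
    exact abs_dist_sub_le _ _ _
  have hae := hglip.ae_differentiableWithinAt_of_mem (μ := (volume : Measure (Fin j → ℝ)))
  obtain ⟨v, hv, hdiff⟩ : ∃ v ∈ O, DifferentiableWithinAt ℝ g O v := by
    by_contra hcon
    push Not at hcon
    have hz : volume O = 0 := by
      refine measure_mono_null ?_ hae
      intro v hv hcontra
      exact hcon v hv (hcontra hv)
    exact (isOpen_ball.measure_pos volume ⟨G y, mem_ball_self hρ⟩).ne' hz
  have hdiffAt : DifferentiableAt ℝ g v := hdiff.differentiableAt (isOpen_ball.mem_nhds hv)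
  set A := fderiv ℝ g v with hA
  have hlt : LinearMap.range (A : (Fin j → ℝ) →ₗ[ℝ] (Fin k → ℝ)) < ⊤ := by
    rw [lt_top_iff_ne_top]
    intro htop
    have h1 := LinearMap.finrank_range_le (A : (Fin j → ℝ) →ₗ[ℝ] (Fin k → ℝ))
    rw [htop, finrank_top] at h1
    simp at h1
    omega
  obtain ⟨f, hf0, hf⟩ := Submodule.exists_le_ker_of_lt_top _ hlt
  refine ⟨φ v, hφ1 v hv, fun i => f (Pi.single i 1), ?_, ?_⟩
  · intro h
    apply hf0
    apply LinearMap.pi_ext'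
    intro i
    ext
    simpa using congrFun h i
  have hfsum : ∀ u : Fin k → ℝ, f u = ∑ i, f (Pi.single i 1) * u i := by
    intro u
    rw [LinearMap.pi_apply_eq_sum_univ f u]
    apply Finset.sum_congr rfl
    intro i _
    rw [smul_eq_mul, mul_comm]
    congr 2
    funext a
    simp [Pi.single_apply, eq_comm]
  intro ε hε
  let F := LinearMap.toContinuousLinearMap f
  have hcomp : HasFDerivAt (fun u => F (g u)) (F.comp A) v :=
    F.hasFDerivAt.comp v hdiffAt.hasFDerivAt
  have hzero : F.comp A = 0 := by
    refine ContinuousLinearMap.ext fun u => ?_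
    exact hf (LinearMap.mem_range_self (A : (Fin j → ℝ) →ₗ[ℝ] (Fin k → ℝ)) u)
  rw [hzero] at hcomp
  have hlo := hcomp.isLittleO.def hε
  have hGw : G (φ v) = v := hφ2 v hv
  have htend : Tendsto G (𝓝 (φ v)) (𝓝 v) := by
    have := hGcont.tendsto (φ v)
    rwa [hGw] at this
  have hO' : ∀ᶠ z in 𝓝 (φ v), G z ∈ O := htend.eventually (isOpen_ball.mem_nhds hv)
  have hB : ∀ᶠ z in 𝓝 (φ v), z ∈ ball y r := isOpen_ball.mem_nhds (hφ1 v hv)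
  filter_upwards [htend.eventually hlo, hO', hB] with z h1 h2 h3
  have hzz : φ (G z) = z := by
    have h4 := hanti _ (ball_subset_closedBall (hφ1 _ h2)) z (ball_subset_closedBall h3)
    rw [hφ2 _ h2] at h4
    have h5 : dist (G z) (fun i => dist (p' i) z) = 0 := dist_self _
    rw [h5] at h4
    have h6 : dist (φ (G z)) z ≤ 0 := by
      by_contra hcon
      push Not at hcon
      nlinarith [mul_pos hη hcon]
    exact dist_le_zero.1 h6
  have h7 : F (g (G z)) - F (g v) = ∑ i, f (Pi.single i 1) * (dist (p i) z - dist (p i) (φ v)) := by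
    rw [← map_sub]
    refine (hfsum _).trans ?_
    apply Finset.sum_congr rfl
    intro i _
    simp only [Pi.sub_apply, g, hzz]
  rw [zero_apply, sub_zero, h7, Real.norm_eq_abs, ← dist_eq_norm] at h1
  refine h1.trans (mul_le_mul_of_nonneg_left ?_ hε.le)
  have := hGlip z (φ v)
  rwa [hGw] at this
lemma compAngle_continuousAt {X : Type*} [MetricSpace X] (p q x : X) (hp : p ≠ x) (hq : q ≠ x) :
    ContinuousAt (fun y => compAngle p y q) x := by
  unfold compAngle
  apply Real.continuous_arccos.continuousAt.comp
  apply ContinuousAt.div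
  · fun_prop
  · fun_prop
  · have := dist_pos.2 hp.symm
    have := dist_pos.2 hq.symm
    positivity

lemma arccos_ratio_continuousAt {X : Type*} [MetricSpace X] (a : ℝ) (p q x : X) (hp : p ≠ x) :
    ContinuousAt (fun y => Real.arccos (1 - a * dist q y / (2 * dist p y))) x := by
  apply Real.continuous_arccos.continuousAt.comp
  apply ContinuousAt.sub continuousAt_const
  apply ContinuousAt.div
  · fun_prop
  · fun_prop
  · have := dist_pos.2 hp
    positivity

lemma eventually_strainer {X : Type*} [MetricSpace X] (S C D δ : ℝ) (x : X) {k : ℕ}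
    (p q : Fin k → X) (h : IsStrainer S C D δ x p q) :
    ∀ᶠ y in 𝓝 x, IsStrainer S C D δ y p q := by
  obtain ⟨hA, hB, hE⟩ := h
  refine Filter.Eventually.and ?_ (Filter.Eventually.and ?_ ?_)
  · rw [eventually_all]
    intro j
    obtain ⟨h1, h2, h3, h4⟩ := hA j
    refine Filter.Eventually.and ?_ (Filter.Eventually.and ?_ (Filter.Eventually.and ?_ ?_))
    · filter_upwards [isOpen_ne.mem_nhds h1.symm] with y hy using hy.symm
    · filter_upwards [isOpen_ne.mem_nhds h2.symm] with y hy using hy.symm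
    · exact (compAngle_continuousAt _ _ _ h1 h2).eventually (lt_mem_nhds h3)
    · exact (arccos_ratio_continuousAt S _ _ _ h1).eventually (gt_mem_nhds h4)
  · rw [eventually_all]
    intro j
    rw [eventually_all]
    intro hj
    have : ContinuousAt (fun y => dist (p j) y) x := by fun_prop
    exact this.eventually (gt_mem_nhds (hB j hj))
  · rw [eventually_all]
    intro i
    rw [eventually_all]
    intro j
    rw [eventually_all]
    intro hij
    obtain ⟨h1, h2, h3⟩ := hE i j hij
    refine Filter.Eventually.and ?_ (Filter.Eventually.and ?_ ?_)
    · exact (arccos_ratio_continuousAt (S+C) _ _ _ (hA i).1).eventually (gt_mem_nhds h1)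
    · exact ((compAngle_continuousAt _ _ _ (hA i).1 (hA j).1).sub continuousAt_const).abs.eventually
        (gt_mem_nhds h2)
    · exact ((compAngle_continuousAt _ _ _ (hA i).1 (hA j).2.1).sub continuousAt_const).abs.eventually
        (gt_mem_nhds h3)

lemma strainer_mono {X : Type*} [MetricSpace X] {S C D D' δ δ' : ℝ} (hD : D ≤ D') (hδ : δ ≤ δ')
    {x : X} {k : ℕ} {p q : Fin k → X} (h : IsStrainer S C D δ x p q) :
    IsStrainer S C D' δ' x p q := by
  obtain ⟨hA, hB, hE⟩ := h
  refine ⟨fun j => ?_, fun j hj => (hB j hj).trans_le hD, fun i j hij => ?_⟩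
  · obtain ⟨h1, h2, h3, h4⟩ := hA j
    exact ⟨h1, h2, by linarith, by linarith⟩
  · obtain ⟨h1, h2, h3⟩ := hE i j hij
    exact ⟨by linarith, by linarith, by linarith⟩

lemma strainer_dist_lt {X : Type*} [MetricSpace X] {S C D δ : ℝ} (hS : 1 ≤ S) (hC : 0 ≤ C)
    (hδ0 : 0 < δ) (hδ : δ < 1/2)
    {x : X} {k : ℕ} {p q : Fin k → X} (h : IsStrainer S C D δ x p q) (i : Fin k) :
    dist (p i) x < D := by
  obtain ⟨hA, hB, hE⟩ := h
  by_cases hi : (i : ℕ) = 0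
  · exact hB i hi
  have hk : 0 < k := lt_of_le_of_lt (Nat.zero_le _) i.2
  have h0i : (⟨0, hk⟩ : Fin k) < i := Fin.lt_def.2 (Nat.pos_of_ne_zero hi)
  have hr := small_of_arccos_one_sub hδ0 hδ (hE _ i h0i).1
  have hd0 := hB ⟨0, hk⟩ rfl
  have hpo : 0 < dist (p ⟨0, hk⟩) x := dist_pos.2 (hA _).1
  have hpi : 0 < dist (p i) x := dist_pos.2 (hA i).1
  rw [div_lt_iff₀ (by linarith)] at hr
  have : δ^2 < 1 := by nlinarith
  nlinarith

lemma extend_strainer {X : Type*} [MetricSpace X] {S C D δ : ℝ} {x : X} {j : ℕ} {p q : Fin j → X}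
    (h : IsStrainer S C D δ x p q) (a b : X) (h1 : IsOneStrainer S δ x a b) (h2 : dist a x < D)
    (h3 : ∀ i, Real.arccos (1 - (S + C) * dist a x / (2 * dist (p i) x)) < δ ∧
      |compAngle (p i) x a - Real.pi / 2| < δ ∧ |compAngle (p i) x b - Real.pi / 2| < δ) :
    IsStrainer S C D δ x (Fin.snoc p a : Fin (j+1) → X) (Fin.snoc q b : Fin (j+1) → X) := by
  obtain ⟨hA, hB, hE⟩ := h
  refine ⟨fun l => ?_, fun l => ?_, fun i l => ?_⟩
  · induction l using Fin.lastCases with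
    | last => simpa using h1
    | cast l => simpa using hA l
  · induction l using Fin.lastCases with
    | last => intro _; simpa using h2
    | cast l => simpa using hB l
  · induction l using Fin.lastCases with
    | last =>
      induction i using Fin.lastCases with
      | last => intro h; exact absurd h (lt_irrefl _)
      | cast i => intro _; simpa using h3 i
    | cast l =>
      induction i using Fin.lastCases with
      | last => intro h; exact absurd h (not_lt.2 (Fin.le_last _))
      | cast i =>
        intro h
        simpa using hE i l (Fin.castSucc_lt_castSucc_iff.1 h)

lemma angle_small {S C κ m ℓ θ d c : ℝ} (hSC : 0 ≤ S + C) (hκ : 0 < κ) (hm : 0 < m) (hℓ : 0 < ℓ)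
    (hθ0 : 0 < θ) (hθ1 : θ ≤ 1) (hd : m / 2 ≤ d) (hℓm : (S + C + 1) * ℓ < κ * m / 4)
    (h : |d^2 - c^2| ≤ θ * (4 * (κ/16) * m * ℓ + (S + C) * ℓ^2)) :
    |(d^2 + (θ*ℓ)^2 - c^2) / (2 * d * (θ*ℓ))| < κ := by
  have hd0 : 0 < d := by linarith
  have hb : 0 < θ * ℓ := by positivity
  rw [abs_div, abs_of_pos (by positivity : 0 < 2 * d * (θ*ℓ)), div_lt_iff₀ (by positivity)]
  have h1 : |d^2 + (θ*ℓ)^2 - c^2| ≤ |d^2 - c^2| + (θ*ℓ)^2 := by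
    have : d^2 + (θ*ℓ)^2 - c^2 = (d^2 - c^2) + (θ*ℓ)^2 := by ring
    rw [this]
    refine (abs_add_le _ _).trans ?_
    rw [abs_of_nonneg (sq_nonneg (θ*ℓ))]
  have h2 : (θ*ℓ)^2 ≤ θ*ℓ*ℓ := by
    rw [sq]; apply mul_le_mul_of_nonneg_left _ hb.le; nlinarith
  have h3 : |d^2 + (θ*ℓ)^2 - c^2| ≤ θ*ℓ * (κ * m / 4 + (S+C+1) * ℓ) := by nlinarith
  have h4 : θ*ℓ * (κ * m / 4 + (S+C+1) * ℓ) < θ * ℓ * (κ * m / 2) :=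
    mul_lt_mul_of_pos_left (by linarith) hb
  have h5 : θ * ℓ * (κ * m / 2) ≤ θ*ℓ * (κ * d) := by
    apply mul_le_mul_of_nonneg_left _ hb.le; nlinarith
  have h6 : 0 < θ*ℓ * (κ * d) := by positivity
  nlinarith

lemma quad_between {S C τ L E dw dz du : ℝ} (hS : 0 ≤ S) (hC : 0 ≤ C) (hL : 0 ≤ L)
    (hτ0 : 0 < τ) (hτ1 : τ < 1)
    (hlow : (1-τ)*dw + τ*dz - S*τ*(1-τ)*L ≤ du)
    (hupp : du ≤ (1-τ)*dw + τ*dz + C*τ*(1-τ)*L) (hE : |dz - dw| ≤ E) :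
    |du - dw| ≤ τ*(E+(S+C)*L) ∧ |du - dz| ≤ (1-τ)*(E+(S+C)*L) := by
  obtain ⟨h1, h2⟩ := abs_le.1 hE
  have hτ' : 0 < 1 - τ := by linarith
  have e1 := mul_le_mul_of_nonneg_left h1 hτ0.le
  have e2 := mul_le_mul_of_nonneg_left h2 hτ0.le
  have e3 := mul_le_mul_of_nonneg_left h1 hτ'.le
  have e4 := mul_le_mul_of_nonneg_left h2 hτ'.le
  have s1 : 0 ≤ S*τ*(1-τ)*L := by positivity
  have c1 : 0 ≤ C*τ*(1-τ)*L := by positivity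
  have s2 : 0 ≤ S*τ*τ*L := by positivity
  have c2 : 0 ≤ C*τ*τ*L := by positivity
  have s3 : 0 ≤ S*(1-τ)*(1-τ)*L := by positivity
  have c3 : 0 ≤ C*(1-τ)*(1-τ)*L := by positivity
  constructor
  · rw [abs_le]; constructor <;> linarith
  · rw [abs_le]; constructor <;> linarith

lemma improve_step {X : Type*} [MetricSpace X]
    (S C D : ℝ) (hS : 1 ≤ S) (hC : 0 ≤ C) (hD : 0 < D)
    (hgeo : IsGeodesicSpace X) (hconc : SConcave X S) (hsemi : LocSemiConvex X C D)
    (δ' κ : ℝ) (hδ0 : 0 < δ') (hκ0 : 0 < κ) (hκ1 : κ ≤ 1)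
    (hk1 : ∀ u, u < κ → Real.arccos (1 - u) < δ')
    (hk2 : ∀ u, |u| < κ → |Real.arccos u - Real.pi/2| < δ')
    {j : ℕ} (p q : Fin j → X) (y : X) (r : ℝ) (hr : 0 < r)
    (hr1 : ∀ u ∈ closedBall y (3*r), IsStrainer S C (D/4) δ' u p q)
    (hm : ∀ i, dist (p i) y < D/4)
    (hr2 : 2 * r < D/4) (hr3 : ∀ i, (S+C+1)*(2*r) < κ * dist (p i) y / 4)
    (hr4 : ∀ i, 3 * r < dist (p i) y / 4)
    (w z : X) (hw : w ∈ closedBall y r) (hz : z ∈ closedBall y r) (hne : z ≠ w)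
    (hwz : ∀ i, |dist (p i) z - dist (p i) w| ≤ κ/16 * dist z w) :
    ∃ u ∈ closedBall y (3*r), ∃ p' q' : Fin (j+1) → X, IsStrainer S C (D/4) δ' u p' q' := by
  obtain ⟨ξ, hξ, h0, h1⟩ := hgeo w z
  set ℓ := dist w z with hℓ
  have hℓ0 : 0 < ℓ := dist_pos.2 hne.symm
  have hSC : 0 ≤ S + C := by linarith
  rw [mem_closedBall] at hw hz
  have hℓr : ℓ ≤ 2 * r := by
    have := dist_triangle_right w z y
    linarith
  have hdist : ∀ t ∈ Icc (0:ℝ) 1, dist (ξ t) y ≤ 3 * r := by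
    intro t ht
    have h2 := hξ t ht 0 (by simp)
    rw [h0, h1, ← hℓ, sub_zero, abs_of_nonneg ht.1] at h2
    have := dist_triangle (ξ t) w y
    nlinarith [ht.2]
  set τ := κ / (4 * S) with hτ
  have hτ0 : 0 < τ := by positivity
  have hτS : S * τ = κ / 4 := by rw [hτ]; field_simp
  have hτ1 : τ ≤ 1/4 := by
    nlinarith
  have hτI : τ ∈ Icc (0:ℝ) 1 := ⟨hτ0.le, by linarith⟩
  set u := ξ τ with hu
  have hu3 : u ∈ closedBall y (3*r) := hdist τ hτI
  have hqu : dist u w = τ * ℓ := by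
    have h2 := hξ τ hτI 0 (by simp)
    rwa [h0, h1, ← hℓ, sub_zero, abs_of_nonneg hτ0.le] at h2
  have hpu : dist u z = (1 - τ) * ℓ := by
    have h2 := hξ τ hτI 1 (by simp)
    rwa [h0, h1, ← hℓ, abs_sub_comm, abs_of_nonneg (by linarith)] at h2
  refine ⟨u, hu3, _, _, extend_strainer (hr1 u hu3) z w ?_ ?_ ?_⟩
  · have hzu : 0 < dist u z := by rw [hpu]; apply mul_pos _ hℓ0; linarith
    have hwu : 0 < dist u w := by rw [hqu]; positivity
    refine ⟨(dist_pos.1 hzu).symm, (dist_pos.1 hwu).symm, ?_, ?_⟩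
    · have : compAngle z u w = Real.pi := by
        unfold compAngle
        rw [← Real.arccos_neg_one]
        congr 1
        rw [div_eq_iff (by positivity), dist_comm z w, ← hℓ, hpu, hqu]
        ring
      rw [this]; linarith
    · apply hk1
      rw [dist_comm w, dist_comm z, hpu, hqu, div_lt_iff₀ (by nlinarith)]
      nlinarith [mul_pos hκ0 hℓ0]
  · rw [dist_comm z, hpu]; nlinarith
  · intro i
    set m := dist (p i) y with hmdef
    have hm0 : 0 < m := by have := hr4 i; linarith
    have hnear : ∀ v, dist v y ≤ 3 * r → m / 2 ≤ dist (p i) v ∧ dist (p i) v ≤ 2 * m := by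
      intro v hv
      have h2 := dist_triangle (p i) v y
      have h3 := dist_triangle_right (p i) v y
      have h4 := hr4 i
      constructor <;> linarith
    have hℓm : (S + C + 1) * ℓ < κ * m / 4 := by
      have := hr3 i
      have : (S + C + 1) * ℓ ≤ (S+C+1)*(2*r) := mul_le_mul_of_nonneg_left hℓr (by linarith)
      linarith
    obtain ⟨hd1, hd2⟩ := hnear u hu3
    obtain ⟨hw1, hw2⟩ := hnear w (by linarith)
    obtain ⟨hz1, hz2⟩ := hnear z (by linarith)
    have hΔ : |dist (p i) z ^ 2 - dist (p i) w ^ 2| ≤ 4 * (κ/16) * m * ℓ := by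
      have h2 : dist (p i) z ^ 2 - dist (p i) w ^ 2 =
        (dist (p i) z - dist (p i) w) * (dist (p i) z + dist (p i) w) := by ring
      have h3 := hwz i
      rw [dist_comm z w, ← hℓ] at h3
      rw [h2, abs_mul, abs_of_nonneg (by linarith : 0 ≤ dist (p i) z + dist (p i) w)]
      calc _ ≤ κ/16 * ℓ * (4 * m) := mul_le_mul h3 (by linarith) (by linarith) (by positivity)
        _ = _ := by ring
    have hlow := hconc (p i) ξ hξ τ hτI
    have hupp := hsemi (p i) ξ hξ (fun t ht => by
      have := (hnear _ (hdist t ht)).2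
      have := hm i
      linarith) τ hτI
    rw [h0, h1, ← hℓ, ← hu] at hlow hupp
    have hτ1' : 0 < 1 - τ := by linarith
    obtain ⟨hb1, hb2⟩ := quad_between (by linarith) hC (sq_nonneg ℓ) hτ0 (by linarith) hlow hupp hΔ
    refine ⟨?_, ?_, ?_⟩
    · apply hk1
      rw [dist_comm z, hpu, div_lt_iff₀ (by linarith)]
      have : κ * m ≤ κ * (2 * dist (p i) u) := mul_le_mul_of_nonneg_left (by linarith) hκ0.le
      have : (S + C) * ((1-τ)*ℓ) ≤ (S+C+1)*ℓ := by
        have : (1-τ)*ℓ ≤ ℓ := by nlinarith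
        nlinarith
      have : 0 < κ * m := by positivity
      linarith
    · apply hk2
      have := angle_small hSC hκ0 hm0 hℓ0 hτ1' (by linarith) hd1 hℓm hb2
      rwa [hpu, dist_comm u (p i)]
    · apply hk2
      have := angle_small hSC hκ0 hm0 hℓ0 hτ0 (by linarith) hd1 hℓm hb1
      rwa [hqu, dist_comm u (p i)]

lemma exists_kappa (δ' : ℝ) (hδ0 : 0 < δ') : ∃ κ : ℝ, 0 < κ ∧ κ ≤ 1 ∧
    (∀ u, u < κ → Real.arccos (1 - u) < δ') ∧
    (∀ u, |u| < κ → |Real.arccos u - Real.pi/2| < δ') := by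
  have c1 : ContinuousAt (fun u : ℝ => Real.arccos (1 - u)) 0 :=
    (Real.continuous_arccos.comp (by fun_prop)).continuousAt
  have c2 : ContinuousAt Real.arccos 0 := Real.continuous_arccos.continuousAt
  obtain ⟨a, ha, h1⟩ := Metric.continuousAt_iff.1 c1 δ' hδ0
  obtain ⟨b, hb, h2⟩ := Metric.continuousAt_iff.1 c2 δ' hδ0
  refine ⟨min 1 (min a b), by positivity, min_le_left _ _, fun u hu => ?_, fun u hu => ?_⟩
  · by_cases hu0 : u ≤ 0
    · rw [Real.arccos_of_one_le (by linarith)]; exact hδ0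
    · push Not at hu0
      have hua : u < a := hu.trans_le ((min_le_right _ _).trans (min_le_left _ _))
      have := h1 (x := u) (by rw [Real.dist_eq, sub_zero, abs_of_pos hu0]; exact hua)
      rw [Real.dist_eq] at this
      simp only [sub_zero, Real.arccos_one] at this
      exact (le_abs_self _).trans_lt this
  · have hub : |u| < b := hu.trans_le ((min_le_right _ _).trans (min_le_right _ _))
    have := h2 (x := u) (by rw [Real.dist_eq, sub_zero]; exact hub)
    rwa [Real.dist_eq, Real.arccos_zero] at this

lemma main_step {X : Type*} [MetricSpace X] [CompleteSpace X]
    (S C D : ℝ) (hS : 1 ≤ S) (hC : 0 ≤ C) (hD : 0 < D)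
    (hgeo : IsGeodesicSpace X) (hconc : SConcave X S) (hsemi : LocSemiConvex X C D)
    {k : ℕ} (δ : ℝ) (hδ0 : 0 < δ) (hδ : δ < 1/2) (hδk : 2^k * (2*δ) ≤ 1)
    (x : X) (p q : Fin k → X) (hx : IsStrainer S C D δ x p q) (j : ℕ) (hj : j < k)
    (ih : ∀ δ' > 0, ∀ U : Set X, IsOpen U → x ∈ U →
      ∃ y ∈ U, ∃ p' q' : Fin j → X, IsStrainer S C (D/4) δ' y p' q') :
    ∀ δ' > 0, ∀ U : Set X, IsOpen U → x ∈ U →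
      ∃ y ∈ U, ∃ p' q' : Fin (j+1) → X, IsStrainer S C (D/4) δ' y p' q' := by
  intro δ' hδ' U hU hxU
  obtain ⟨V, hV, hVo, hxV⟩ := _root_.eventually_nhds_iff.1 (eventually_strainer S C D δ x p q hx)
  set δ₁ := min δ' (min (1/4) ((1/2)^j / (2*(j+1)))) with hδ₁
  have hd0 : 0 < δ₁ := by positivity
  have hd1 : δ₁ ≤ δ' := min_le_left _ _
  have hd2 : δ₁ ≤ 1/4 := (min_le_right _ _).trans (min_le_left _ _)
  have hd3 : δ₁ ≤ (1/2)^j / (2*(j+1)) := (min_le_right _ _).trans (min_le_right _ _)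
  have hjd : (j:ℝ) * (2*δ₁) ≤ (1/2)^j := by
    rw [le_div_iff₀ (by positivity)] at hd3
    nlinarith
  obtain ⟨y, ⟨hyU, hyV⟩, p', q', hst⟩ := ih δ₁ hd0 (U ∩ V) (hU.inter hVo) ⟨hxU, hxV⟩
  obtain ⟨κ, hκ0, hκ1, hk1, hk2⟩ := exists_kappa δ' hδ'
  have hev : ∀ᶠ w in 𝓝 y, w ∈ U ∧ w ∈ V ∧ IsStrainer S C (D/4) δ₁ w p' q' :=
    Filter.Eventually.and (hU.mem_nhds hyU) (Filter.Eventually.and (hVo.mem_nhds hyV) (eventually_strainer _ _ _ _ _ _ _ hst))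
  obtain ⟨r₀, hr₀, hball⟩ := Metric.eventually_nhds_iff.1 hev
  have hpos : ∀ i, 0 < dist (p' i) y := fun i => dist_pos.2 (hst.1 i).1
  have hsmall : ∀ (a b : ℝ), 0 < b → ∀ᶠ r in 𝓝[>] (0:ℝ), a * r < b := by
    intro a b hb
    have : ContinuousAt (fun r : ℝ => a * r) 0 := by fun_prop
    exact nhdsWithin_le_nhds (this.eventually (gt_mem_nhds (by simpa using hb)))
  have hrev : ∀ᶠ r in 𝓝[>] (0:ℝ), 3 * r < r₀ ∧ 2 * r < D/4 ∧
      (∀ i, (S+C+1)*2*r < κ * dist (p' i) y / 4) ∧ (∀ i, 3 * r < dist (p' i) y / 4) ∧ 0 < r := by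
    refine (hsmall _ _ hr₀).and ((hsmall _ _ (by linarith)).and (Filter.Eventually.and ?_
      (Filter.Eventually.and ?_ self_mem_nhdsWithin)))
    · rw [eventually_all]; intro i
      have := hpos i
      exact hsmall _ _ (by positivity)
    · rw [eventually_all]; intro i
      have := hpos i
      exact hsmall _ _ (by positivity)
  obtain ⟨r, hr1, hr2, hr3, hr4, hr0⟩ := hrev.exists
  have hb3 : ∀ w ∈ closedBall y (3*r), w ∈ U ∧ w ∈ V ∧ IsStrainer S C (D/4) δ₁ w p' q' := by
    intro w hw
    exact hball (lt_of_le_of_lt (mem_closedBall.1 hw) hr1)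
  by_cases hex : ∃ z ∈ closedBall y r, ∃ w ∈ closedBall y r, z ≠ w ∧
      ∀ i, |dist (p' i) z - dist (p' i) w| ≤ κ/16 * dist z w
  · obtain ⟨z, hz, w, hw, hne, hzw⟩ := hex
    obtain ⟨u, hu, p'', q'', h⟩ := improve_step S C D hS hC hD hgeo hconc hsemi δ' κ hδ' hκ0 hκ1
      hk1 hk2 p' q' y r hr0 (fun u hu => strainer_mono le_rfl hd1 (hb3 u hu).2.2)
      (fun i => strainer_dist_lt hS hC hd0 (by linarith) hst i) hr2
      (fun i => by have := hr3 i; linarith) hr4 w z hw hz hne hzw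
    exact ⟨u, (hb3 u hu).1, p'', q'', h⟩
  · exfalso
    have hanti : ∀ z ∈ closedBall y r, ∀ w ∈ closedBall y r,
        κ/16 * dist z w ≤ dist (fun i => dist (p' i) z) (fun i => dist (p' i) w) := by
      intro z hz w hw
      by_cases hne : z = w
      · subst hne; simp
      by_contra hcon
      push Not at hcon
      refine hex ⟨z, hz, w, hw, hne, fun i => ?_⟩
      have := dist_le_pi_dist (fun i => dist (p' i) z) (fun i => dist (p' i) w) i
      rw [Real.dist_eq] at this
      linarith
    have hin : ∀ w ∈ ball y r, w ∈ closedBall y (3*r) := by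
      intro w hw
      rw [mem_ball] at hw
      rw [mem_closedBall]; linarith
    obtain ⟨ρ, hρ, hopen⟩ := open_map p' y r (κ/16) (2*δ₁) hr0 (by positivity) (by positivity) hjd
      hanti (by
        intro w hw l s hs
        obtain ⟨ξ, b, hb, hd, he⟩ := rateAt_of_strainer S C D hS hC hgeo hconc hsemi δ₁ (D/4) hd0
          (by linarith) (by linarith) w p' q' (hb3 w (hin w hw)).2.2 l s hs
        refine ⟨ξ, b, hb, hd, ?_⟩
        filter_upwards [he] with t ht
        exact ⟨ht.1, fun i hi => ⟨(ht.2 i hi).1, fun _ => (ht.2 i hi).2 (Or.inr (by linarith))⟩⟩)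
    obtain ⟨w, hw, c, hc, hstat⟩ := exists_stationary hj p' p y r (κ/16) ρ (by positivity) hρ
      hanti hopen
    have hrate : RateAt p w (2*δ) (fun i => (i:ℕ) ≠ 0) := by
      intro l s hs
      obtain ⟨ξ, b, hb, hd, he⟩ := rateAt_of_strainer S C D hS hC hgeo hconc hsemi δ D hδ0
        hδ le_rfl w p q (hV w (hb3 w (hin w hw)).2.1) l s hs
      refine ⟨ξ, b, hb, hd, ?_⟩
      filter_upwards [he] with t ht
      exact ⟨ht.1, fun i hi => ⟨(ht.2 i hi).1, fun h => (ht.2 i hi).2 (Or.inl h)⟩⟩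
    have hk : 0 < k := by omega
    rcases le_total 0 (c ⟨0, hk⟩) with h0 | h0
    · refine hc (no_stationary p w (2*δ) (by positivity) hδk hrate c (fun i hi => ?_) hstat)
      have : i = ⟨0, hk⟩ := Fin.ext hi
      rw [this]; exact h0
    · have := no_stationary p w (2*δ) (by positivity) hδk hrate (-c) (fun i hi => ?_) (fun η hη => ?_)
      · exact hc (neg_eq_zero.1 this)
      · have : i = ⟨0, hk⟩ := Fin.ext hi
        rw [this, Pi.neg_apply]; linarith
      · filter_upwards [hstat η hη] with z hz
        simpa only [Pi.neg_apply, neg_mul, Finset.sum_neg_distrib, abs_neg] using hz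

/-- self-improvement of strainers: near a `(k,δ)`-strained point
there are `(k,δ')`-strained points for every `δ' < δ`. -/
theorem stmt_17 {X : Type*} [MetricSpace X] [CompleteSpace X]
    (S C D : ℝ) (hS : 1 ≤ S) (hC : 0 ≤ C) (hD : 0 < D)
    (hgeo : IsGeodesicSpace X) (hconc : SConcave X S)
    (hsemi : LocSemiConvex X C D)
    (k : ℕ) (δ : ℝ) (hδ0 : 0 < δ) (hδ : δ < strainerDelta k)
    (x : X) (hx : x ∈ strainedPoints X S C D δ k) :
    ∀ δ' : ℝ, 0 < δ' → δ' < δ →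
      ∀ U : Set X, IsOpen U → x ∈ U →
        ∃ y ∈ U, y ∈ strainedPoints X S C D δ' k := by
  intro δ' hδ'0 _ U hU hxU
  obtain ⟨p, q, hpq⟩ := hx
  have hk : 0 < k := by
    rcases Nat.eq_zero_or_pos k with h | h
    · subst h
      simp [strainerDelta] at hδ
      linarith
    · exact h
  have hk1 : (1:ℝ) ≤ k := by exact_mod_cast hk
  have hpow : (1:ℝ) ≤ 2^k := one_le_pow₀ (by norm_num)
  have hmain : δ * (k * 2^(2*k+1)) < 1 := by
    have hpos : 0 < (k:ℝ) * 2^(2*k+1) := by positivity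
    unfold strainerDelta at hδ
    calc _ < ((k:ℝ) * 2^(2*k+1))⁻¹ * (k * 2^(2*k+1)) := mul_lt_mul_of_pos_right hδ hpos
      _ = 1 := inv_mul_cancel₀ hpos.ne'
  have he : (2:ℝ)^(2*k+1) = 2^k * 2^k * 2 := by ring
  rw [he] at hmain
  have hA : 2^k * (2*δ) ≤ 1 := by
    have h1 : (1:ℝ) ≤ k * 2^k := by nlinarith
    have h2 : 0 ≤ 2^k * (2*δ) := by positivity
    nlinarith
  have hB : δ < 1/2 := by
    have h1 : (1:ℝ) < 2^k := one_lt_pow₀ (by norm_num) hk.ne'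
    nlinarith
  have key : ∀ j : ℕ, j ≤ k → ∀ δ' > 0, ∀ U : Set X, IsOpen U → x ∈ U →
      ∃ y ∈ U, ∃ p' q' : Fin j → X, IsStrainer S C (D/4) δ' y p' q' := by
    intro j
    induction j with
    | zero =>
      intro _ δ' _ U _ hxU
      exact ⟨x, hxU, Fin.elim0, Fin.elim0, fun i => i.elim0, fun i => i.elim0, fun i => i.elim0⟩
    | succ j ih =>
      intro hj
      exact main_step S C D hS hC hD hgeo hconc hsemi δ hδ0 hB hA x p q hpq j hj
        (ih (by omega))
  obtain ⟨y, hy, p', q', h⟩ := key k le_rfl δ' hδ'0 U hU hxU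
  exact ⟨y, hy, p', q', strainer_mono (by linarith) le_rfl h⟩
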